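/- arXiv:1603.09705 — 2 statements merged into one kernel-verified Lean document; each statement's English description precedes it below -/
import Mathlib

section
/- Let A be a nontrivial commutative C-algebra which is an integral domain, and let V and W be nonzero finite-dimensional C-linear subspaces of A. Then the C-linear span of the set of products {v*w : v in V, w in W} has dimension at least (dim V) + (dim W) - 1. -/
theorem LinearMap.mulLeft_injective_of_ne_zero (K : Type*) {A : Type*} [Field K] [CommRing A]
    [IsDomain A] [Algebra K A] {a : A} (ha : a ≠ 0) :
    Function.Injective (LinearMap.mulLeft K a) :=
  fun _ _ h => mul_left_cancel₀ ha h

namespace Submodule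

theorem finiteDimensional_mul {K A : Type*} [Field K] [CommRing A] [Algebra K A]
    (V W : Submodule K A) [FiniteDimensional K V] [FiniteDimensional K W] :
    FiniteDimensional K (V * W : Submodule K A) :=
  Module.Finite.iff_fg.2 <|
    FG.mul (Module.Finite.iff_fg.1 inferInstance) (Module.Finite.iff_fg.1 inferInstance)

variable {K A : Type*} [Field K] [CommRing A] [IsDomain A] [Algebra K A]

theorem finrank_map_mulLeft (V : Submodule K A) {a : A} (ha : a ≠ 0) :
    Module.finrank K (V.map (LinearMap.mulLeft K a)) = Module.finrank K V :=
  (V.equivMapOfInjective _ (LinearMap.mulLeft_injective_of_ne_zero K ha)).finrank_eq.symm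

theorem finrank_le_finrank_mul (V : Submodule K A) {W : Submodule K A} (hW : W ≠ ⊥)
    [FiniteDimensional K V] [FiniteDimensional K W] :
    Module.finrank K V ≤ Module.finrank K (V * W : Submodule K A) := by
  obtain ⟨w, hw, hw0⟩ := W.exists_mem_ne_zero_of_ne_bot hW
  rw [← V.finrank_map_mulLeft hw0]
  have := V.finiteDimensional_mul W
  refine finrank_mono ?_
  rintro _ ⟨v, hv, rfl⟩
  rw [LinearMap.mulLeft_apply, mul_comm w]
  exact mul_mem_mul hv hw

/-- If `(W / w) V ⊆ V` for some nonzero `w`, then `W` is contained in the line through `w`. -/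
theorem le_span_singleton_of_mul_mem_map_mulLeft [IsAlgClosed K] {V W : Submodule K A}
    (hV : V ≠ ⊥) [FiniteDimensional K V] {w : A} (hw : w ≠ 0)
    (h : ∀ v ∈ V, ∀ y ∈ W, v * y ∈ V.map (LinearMap.mulLeft K w)) :
    W ≤ K ∙ w := by
  intro y hy
  have : Nontrivial V := nontrivial_iff_ne_bot.2 hV
  let e := V.equivMapOfInjective _ (LinearMap.mulLeft_injective_of_ne_zero K hw)
  let g : V →ₗ[K] V.map (LinearMap.mulLeft K w) :=
    ((LinearMap.mulLeft K y).domRestrict V).codRestrict _ fun v => by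
      simpa [mul_comm] using h v v.2 y hy
  obtain ⟨c, hc⟩ := Module.End.exists_eigenvalue (e.symm.toLinearMap ∘ₗ g)
  obtain ⟨v, hv⟩ := hc.exists_hasEigenvector
  have hg : g v = e (c • v) := e.symm_apply_eq.1 hv.apply_eq_smul
  have hyv : y * (v : A) = w * (c • (v : A)) := congrArg Subtype.val hg
  have hv0 : (v : A) ≠ 0 := fun h0 => hv.2 (Subtype.ext h0)
  refine mem_span_singleton.2 ⟨c, mul_right_cancel₀ hv0 ?_⟩
  rw [hyv, mul_smul_comm, smul_mul_assoc]

/-- The linear Cauchy–Davenport inequality over an algebraically closed field, by the linear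
analogue of the Dyson transform. -/
theorem finrank_add_finrank_le_finrank_mul_add_one [IsAlgClosed K] (V W : Submodule K A)
    (hV : V ≠ ⊥) (hW : W ≠ ⊥) [FiniteDimensional K V] [FiniteDimensional K W] :
    Module.finrank K V + Module.finrank K W ≤
      Module.finrank K (V * W : Submodule K A) + 1 := by
  induction hn : Module.finrank K W using Nat.strong_induction_on generalizing V W with
  | _ n ih =>
  subst hn
  obtain ⟨w, hw, hw0⟩ := W.exists_mem_ne_zero_of_ne_bot hW
  by_cases h : ∀ v ∈ V, ∀ y ∈ W, v * y ∈ V.map (LinearMap.mulLeft K w)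
  · have h₁ := finrank_mono (le_span_singleton_of_mul_mem_map_mulLeft hV hw0 h)
    rw [finrank_span_singleton hw0] at h₁
    have h₂ := V.finrank_le_finrank_mul hW
    lia
  push Not at h
  obtain ⟨v, hv, y, hy, hvy⟩ := h
  have hv0 : v ≠ 0 := by
    rintro rfl
    simp at hvy
  set wV := V.map (LinearMap.mulLeft K w)
  set vW := W.map (LinearMap.mulLeft K v) with hvW
  set W' := W ⊓ wV.comap (LinearMap.mulLeft K v)
  have hlt : W' < W := lt_of_le_of_ne inf_le_left fun h => hvy (h.ge hy).2
  have hwW' : w ∈ W' := ⟨hw, v, hv, mul_comm w v⟩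
  have : FiniteDimensional K W' := finiteDimensional_of_le hlt.le
  have hsup : wV ⊔ vW ≠ ⊥ := fun h =>
    mul_ne_zero hw0 hv0 <| (mem_bot K).1 <|
      h ▸ mem_sup_left (mem_map_of_mem (f := LinearMap.mulLeft K w) hv)
  have key := ih _ (finrank_lt_finrank_of_lt hlt) (wV ⊔ vW) W' hsup
    (fun h => hw0 ((mem_bot K).1 (h ▸ hwW'))) rfl
  have hle : (wV ⊔ vW) * W' ≤ (V * W).map (LinearMap.mulLeft K w) := by
    rw [sup_mul, sup_le_iff, mul_le, mul_le]
    constructor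
    · rintro _ ⟨a, ha, rfl⟩ b hb
      exact ⟨a * b, mul_mem_mul ha hb.1, (mul_assoc w a b).symm⟩
    · rintro _ ⟨a, ha, rfl⟩ b ⟨-, c, hc, hcb⟩
      refine ⟨c * a, mul_mem_mul hc ha, ?_⟩
      simp only [LinearMap.mulLeft_apply] at hcb ⊢
      linear_combination a * hcb
  have hinf : wV ⊓ vW = W'.map (LinearMap.mulLeft K v) := by
    rw [inf_comm, hvW, map_inf_eq_map_inf_comap]
  have hdim := finrank_sup_add_finrank_inf_eq wV vW
  rw [hinf, finrank_map_mulLeft _ hv0, finrank_map_mulLeft _ hw0, finrank_map_mulLeft _ hv0]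
    at hdim
  have := V.finiteDimensional_mul W
  have hmono := finrank_mono hle
  rw [finrank_map_mulLeft _ hw0] at hmono
  lia

end Submodule

/-- If `A` is a nontrivial commutative `ℂ`-algebra that is an integral
domain and `V, W` are nonzero finite-dimensional `ℂ`-subspaces of `A`, then the span of
the set of products `{v * w : v ∈ V, w ∈ W}` has dimension at least
`dim V + dim W - 1`. -/
theorem stmt_1 (A : Type*) [CommRing A] [IsDomain A] [Algebra ℂ A]
    (V W : Submodule ℂ A) (hV : V ≠ ⊥) (hW : W ≠ ⊥)
    [FiniteDimensional ℂ V] [FiniteDimensional ℂ W] :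
    Module.finrank ℂ V + Module.finrank ℂ W - 1 ≤
      Module.finrank ℂ
        (Submodule.span ℂ {x : A | ∃ v ∈ V, ∃ w ∈ W, x = v * w}) := by
  have h : Submodule.span ℂ {x : A | ∃ v ∈ V, ∃ w ∈ W, x = v * w} = V * W := by
    rw [Submodule.mul_eq_span_mul_set]
    congr 1
    ext x
    simp [Set.mem_mul, eq_comm]
  rw [h, Nat.sub_le_iff_le_add]
  exact Submodule.finrank_add_finrank_le_finrank_mul_add_one V W hV hW
end

section
/- Define g : R^3 -> R by g(x,y,z) = (1/576) * ( 48 x y z - 2 y^3 - 6 y (x + z - y)^2 + max(2y - x - z, 0)^3 + max(z - 3x, 0)^3 + max(x - 3z, 0)^3 - max(x - 2y - 3z, 0)^3 - max(z - 2y - 3x, 0)^3 ), and w : R^3 -> R by w(x,y,z) = x y z (x+y)(y+z)(x+y+z)/12. Then 119750400 times the Lebesgue integral of g * w over the region {(x,y,z) in R^3 : 0 < x, 0 < y, 0 < z, x + 2y + 3z < 4, 3x + 2y + z < 12, x + 2y + z < 4} equals 56960. -/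
open MeasureTheory

/-- The asymptotic dimension of `SL₂`-invariants in irreducible `SL₄`-representations
(the paper's Corollary `finalformula`). -/
noncomputable def gInv (p : ℝ × ℝ × ℝ) : ℝ :=
  (1 / 576) *
    (48 * p.1 * p.2.1 * p.2.2 - 2 * p.2.1 ^ 3 -
      6 * p.2.1 * (p.1 + p.2.2 - p.2.1) ^ 2 +
      max (2 * p.2.1 - p.1 - p.2.2) 0 ^ 3 +
      max (p.2.2 - 3 * p.1) 0 ^ 3 + max (p.1 - 3 * p.2.2) 0 ^ 3 -
      max (p.1 - 2 * p.2.1 - 3 * p.2.2) 0 ^ 3 -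
      max (p.2.2 - 2 * p.2.1 - 3 * p.1) 0 ^ 3)

/-- The asymptotic Weyl dimension for `SL₄`. -/
noncomputable def wDim (p : ℝ × ℝ × ℝ) : ℝ :=
  p.1 * p.2.1 * p.2.2 * (p.1 + p.2.1) * (p.2.1 + p.2.2) *
    (p.1 + p.2.1 + p.2.2) / 12

open Set Nat in
/-- Euler's Beta integral at natural parameters, on the interval `[0, s]`. -/
theorem integral_pow_mul_sub_pow (s : ℝ) (j n : ℕ) :
    ∫ x in (0 : ℝ)..s, x ^ j * (s - x) ^ n = j ! * n ! / (j + n + 1)! * s ^ (j + n + 1) := by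
  induction n generalizing j with
  | zero =>
    simp only [pow_zero, mul_one, integral_pow, add_zero, Nat.factorial_succ, Nat.factorial_zero]
    have := Nat.factorial_ne_zero j
    push_cast
    rw [zero_pow (Nat.succ_ne_zero j)]
    field_simp
    ring
  | succ n ih =>
    have hderiv : ∀ x ∈ uIcc 0 s, HasDerivAt (fun x : ℝ => x ^ (j + 1) * (s - x) ^ (n + 1))
        ((j + 1) * (x ^ j * (s - x) ^ (n + 1)) - (n + 1) * (x ^ (j + 1) * (s - x) ^ n)) x := by
      intro x _
      refine ((hasDerivAt_pow (j + 1) x).mul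
        (((hasDerivAt_id x).const_sub s).pow (n + 1))).congr_deriv ?_
      simp only [Pi.pow_apply, id_eq, Nat.add_sub_cancel]
      push_cast
      ring
    have key := intervalIntegral.integral_eq_sub_of_hasDerivAt hderiv
      (Continuous.intervalIntegrable (by fun_prop) _ _)
    rw [intervalIntegral.integral_sub (Continuous.intervalIntegrable (by fun_prop) _ _)
      (Continuous.intervalIntegrable (by fun_prop) _ _), intervalIntegral.integral_const_mul,
      intervalIntegral.integral_const_mul, ih] at key
    have hj : (j : ℝ) + 1 ≠ 0 := by positivity
    have h : j + 1 + n + 1 = j + (n + 1) + 1 := by ring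
    rw [h] at key
    simp only [sub_self, ne_eq, Nat.add_eq_zero_iff, one_ne_zero, and_false, not_false_eq_true,
      zero_pow, mul_zero, zero_mul, sub_eq_zero] at key
    apply mul_left_cancel₀ hj
    rw [key, Nat.factorial_succ j, Nat.factorial_succ n]
    push_cast
    ring

/-- Fubini's theorem for a set integral, slicing along the first coordinate. -/
theorem setIntegral_eq_integral_slice {E : Type*} [MeasureSpace E] [SFinite (volume : Measure E)]
    {S : Set (ℝ × E)} (hS : MeasurableSet S) {f : ℝ × E → ℝ} (hf : IntegrableOn f S) :
    ∫ p in S, f p = ∫ a, ∫ q in Prod.mk a ⁻¹' S, f (a, q) := by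
  rw [← integral_indicator hS, Measure.volume_eq_prod,
    integral_prod _ (hf.integrable_indicator hS)]
  congr 1
  funext a
  rw [← integral_indicator (measurable_prodMk_left hS)]
  rfl

open Nat in
theorem integral_pow_mul_pow_triangle {s : ℝ} (hs : 0 ≤ s) (j k : ℕ) :
    ∫ q in {q : ℝ × ℝ | 0 < q.1 ∧ 0 < q.2 ∧ q.1 + q.2 < s}, q.1 ^ j * q.2 ^ k =
      j ! * k ! / (j + k + 2)! * s ^ (j + k + 2) := by
  have hopen : IsOpen {q : ℝ × ℝ | 0 < q.1 ∧ 0 < q.2 ∧ q.1 + q.2 < s} := by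
    refine .and (isOpen_lt ?_ ?_) (.and (isOpen_lt ?_ ?_) (isOpen_lt ?_ ?_)) <;> fun_prop
  have hint : IntegrableOn (fun q : ℝ × ℝ => q.1 ^ j * q.2 ^ k)
      {q : ℝ × ℝ | 0 < q.1 ∧ 0 < q.2 ∧ q.1 + q.2 < s} := by
    refine (ContinuousOn.integrableOn_compact (K := Set.Icc (0, 0) (s, s)) isCompact_Icc
      (by fun_prop)).mono_set ?_
    rintro ⟨b, c⟩ ⟨h1, h2, h3⟩
    simp only [Set.mem_Icc, Prod.mk_le_mk] at h1 h2 h3 ⊢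
    refine ⟨⟨?_, ?_⟩, ?_, ?_⟩ <;> linarith
  have hslice : ∀ a : ℝ, ∫ c in Prod.mk a ⁻¹' {q : ℝ × ℝ | 0 < q.1 ∧ 0 < q.2 ∧ q.1 + q.2 < s},
      a ^ j * c ^ k = (Set.Ioc 0 s).indicator
        (fun a => (1 / ((k : ℝ) + 1)) * (a ^ j * (s - a) ^ (k + 1))) a := by
    intro a
    by_cases ha : a ∈ Set.Ioc 0 s
    · have hset : Prod.mk a ⁻¹' {q : ℝ × ℝ | 0 < q.1 ∧ 0 < q.2 ∧ q.1 + q.2 < s} =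
          Set.Ioo 0 (s - a) := by
        ext c
        simp [ha.1, lt_sub_iff_add_lt']
      rw [Set.indicator_of_mem ha, hset, ← integral_Ioc_eq_integral_Ioo,
        ← intervalIntegral.integral_of_le (sub_nonneg.2 ha.2),
        intervalIntegral.integral_const_mul, integral_pow]
      simp
      ring
    · have hset : Prod.mk a ⁻¹' {q : ℝ × ℝ | 0 < q.1 ∧ 0 < q.2 ∧ q.1 + q.2 < s} = ∅ := by
        ext c
        simp only [Set.mem_preimage, Set.mem_ofPred_eq, Set.mem_empty_iff_false, iff_false]
        rintro ⟨h1, h2, h3⟩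
        exact ha ⟨h1, by linarith⟩
      rw [Set.indicator_of_notMem ha, hset]
      simp
  rw [setIntegral_eq_integral_slice hopen.measurableSet hint]
  simp_rw [hslice]
  rw [integral_indicator measurableSet_Ioc, ← intervalIntegral.integral_of_le hs,
    intervalIntegral.integral_const_mul, integral_pow_mul_sub_pow, Nat.factorial_succ k,
    show j + (k + 1) + 1 = j + k + 2 by ring]
  push_cast
  field_simp

/-- The open standard simplex in `ℝ³`. -/
def openSimplex : Set (ℝ × ℝ × ℝ) :=
  {p | 0 < p.1 ∧ 0 < p.2.1 ∧ 0 < p.2.2 ∧ p.1 + p.2.1 + p.2.2 < 1}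

theorem isOpen_openSimplex : IsOpen openSimplex := by
  refine .and (isOpen_lt ?_ ?_) (.and (isOpen_lt ?_ ?_)
    (.and (isOpen_lt ?_ ?_) (isOpen_lt ?_ ?_))) <;> fun_prop

theorem Continuous.integrableOn_openSimplex {f : ℝ × ℝ × ℝ → ℝ} (hf : Continuous f) :
    IntegrableOn f openSimplex := by
  refine (hf.continuousOn.integrableOn_compact
    (K := Set.Icc (0, 0, 0) (1, 1, 1)) isCompact_Icc).mono_set ?_
  rintro ⟨a, b, c⟩ ⟨h1, h2, h3, h4⟩
  simp only [Set.mem_Icc, Prod.mk_le_mk] at h1 h2 h3 h4 ⊢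
  refine ⟨⟨?_, ?_, ?_⟩, ?_, ?_, ?_⟩ <;> linarith

open Nat in
/-- Dirichlet's formula for the moments of the standard simplex. -/
theorem integral_monomial_openSimplex (i j k : ℕ) :
    ∫ p in openSimplex, p.1 ^ i * (p.2.1 ^ j * p.2.2 ^ k) =
      i ! * j ! * k ! / (i + j + k + 3)! := by
  have hslice : ∀ a : ℝ, ∫ q in Prod.mk a ⁻¹' openSimplex, a ^ i * (q.1 ^ j * q.2 ^ k) =
      (Set.Ioc 0 1).indicator (fun a : ℝ => ((j ! * k ! / (j + k + 2)! : ℝ)) *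
        (a ^ i * (1 - a) ^ (j + k + 2))) a := by
    intro a
    by_cases ha : a ∈ Set.Ioc (0 : ℝ) 1
    · have hset : Prod.mk a ⁻¹' openSimplex =
          {q : ℝ × ℝ | 0 < q.1 ∧ 0 < q.2 ∧ q.1 + q.2 < 1 - a} := by
        ext q
        simp [openSimplex, ha.1, lt_sub_iff_add_lt', add_assoc]
      rw [Set.indicator_of_mem ha, hset, integral_const_mul,
        integral_pow_mul_pow_triangle (sub_nonneg.2 ha.2)]
      ring
    · have hset : Prod.mk a ⁻¹' openSimplex = ∅ := by
        ext q
        simp only [openSimplex, Set.mem_preimage, Set.mem_ofPred_eq, Set.mem_empty_iff_false,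
          iff_false]
        rintro ⟨h1, h2, h3, h4⟩
        exact ha ⟨h1, by linarith⟩
      rw [Set.indicator_of_notMem ha, hset]
      simp
  rw [setIntegral_eq_integral_slice isOpen_openSimplex.measurableSet
    (Continuous.integrableOn_openSimplex (by fun_prop))]
  simp_rw [hslice]
  rw [integral_indicator measurableSet_Ioc, ← intervalIntegral.integral_of_le zero_le_one,
    intervalIntegral.integral_const_mul, integral_pow_mul_sub_pow,
    show i + (j + k + 2) + 1 = i + j + k + 3 by ring]
  have := Nat.factorial_ne_zero (j + k + 2)
  field_simp
  simp

/-- The value of the linear form with coefficient vector `l` at `p`. -/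
def linForm (l : ℚ × ℚ × ℚ) (p : ℝ × ℝ × ℝ) : ℝ :=
  l.1 * p.1 + l.2.1 * p.2.1 + l.2.2 * p.2.2

open Nat in
/-- The integral over the standard simplex of the monomial with exponents `i, j, k` times a product
of linear forms, computed by expanding one form at a time. -/
def simplexMoment : List (ℚ × ℚ × ℚ) → ℕ → ℕ → ℕ → ℚ
  | [], i, j, k => i ! * j ! * k ! / (i + j + k + 3)!
  | l :: ls, i, j, k => l.1 * simplexMoment ls (i + 1) j k +
      l.2.1 * simplexMoment ls i (j + 1) k + l.2.2 * simplexMoment ls i j (k + 1)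

@[fun_prop]
theorem continuous_linForm (l : ℚ × ℚ × ℚ) : Continuous (linForm l) := by
  unfold linForm
  fun_prop

theorem continuous_prod_linForm (ls : List (ℚ × ℚ × ℚ)) :
    Continuous fun p => (ls.map fun l => linForm l p).prod :=
  continuous_list_prod ls fun l _ => continuous_linForm l

theorem integral_monomial_mul_linForms (ls : List (ℚ × ℚ × ℚ)) (i j k : ℕ) :
    ∫ p in openSimplex, p.1 ^ i * (p.2.1 ^ j * p.2.2 ^ k) * (ls.map fun l => linForm l p).prod =
      simplexMoment ls i j k := by
  induction ls generalizing i j k with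
  | nil =>
    simp only [List.map_nil, List.prod_nil, mul_one, integral_monomial_openSimplex, simplexMoment]
    push_cast
    rfl
  | cons l ls ih =>
    have hc := continuous_prod_linForm ls
    have hi : ∀ (c : ℝ) (i j k : ℕ), IntegrableOn (fun p : ℝ × ℝ × ℝ =>
        c * (p.1 ^ i * (p.2.1 ^ j * p.2.2 ^ k) * (ls.map fun l => linForm l p).prod))
        openSimplex := fun c i j k => Continuous.integrableOn_openSimplex (by fun_prop)
    have hexp : ∀ p : ℝ × ℝ × ℝ, p.1 ^ i * (p.2.1 ^ j * p.2.2 ^ k) *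
        ((l :: ls).map fun l => linForm l p).prod =
        l.1 * (p.1 ^ (i + 1) * (p.2.1 ^ j * p.2.2 ^ k) * (ls.map fun l => linForm l p).prod) +
        l.2.1 * (p.1 ^ i * (p.2.1 ^ (j + 1) * p.2.2 ^ k) * (ls.map fun l => linForm l p).prod) +
        l.2.2 * (p.1 ^ i * (p.2.1 ^ j * p.2.2 ^ (k + 1)) *
          (ls.map fun l => linForm l p).prod) := by
      intro p
      rw [List.map_cons, List.prod_cons, linForm]
      ring
    simp_rw [hexp]
    rw [integral_add (by exact (hi _ _ _ _).add (hi _ _ _ _)) (hi _ _ _ _),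
      integral_add (hi _ _ _ _) (hi _ _ _ _)]
    simp only [integral_const_mul, ih, simplexMoment]
    push_cast
    rfl

/-- The linear map sending the standard basis of `ℝ³` to `u, v, w`. -/
def linearMapOfCols (u v w : ℝ × ℝ × ℝ) : (ℝ × ℝ × ℝ) →ₗ[ℝ] (ℝ × ℝ × ℝ) :=
  (LinearMap.fst ℝ ℝ (ℝ × ℝ)).smulRight u +
    (LinearMap.fst ℝ ℝ ℝ ∘ₗ LinearMap.snd ℝ ℝ (ℝ × ℝ)).smulRight v +
    (LinearMap.snd ℝ ℝ ℝ ∘ₗ LinearMap.snd ℝ ℝ (ℝ × ℝ)).smulRight w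

theorem linearMapOfCols_apply (u v w p : ℝ × ℝ × ℝ) :
    linearMapOfCols u v w p = p.1 • u + p.2.1 • v + p.2.2 • w := rfl

/-- Coordinates on `ℝ × ℝ × ℝ` indexed by `Fin 3`. -/
def prodEquivFun : (ℝ × ℝ × ℝ) ≃ₗ[ℝ] (Fin 3 → ℝ) where
  toFun p := ![p.1, p.2.1, p.2.2]
  invFun x := (x 0, x 1, x 2)
  map_add' p q := by ext i; fin_cases i <;> rfl
  map_smul' c p := by ext i; fin_cases i <;> rfl
  left_inv p := rfl
  right_inv x := by ext i; fin_cases i <;> rfl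

theorem det_linearMapOfCols (u v w : ℝ × ℝ × ℝ) :
    LinearMap.det (linearMapOfCols u v w) =
      u.1 * (v.2.1 * w.2.2 - v.2.2 * w.2.1) - v.1 * (u.2.1 * w.2.2 - u.2.2 * w.2.1) +
        w.1 * (u.2.1 * v.2.2 - u.2.2 * v.2.1) := by
  have h : LinearMap.toMatrix (Module.Basis.ofEquivFun prodEquivFun)
      (Module.Basis.ofEquivFun prodEquivFun) (linearMapOfCols u v w) =
      !![u.1, v.1, w.1; u.2.1, v.2.1, w.2.1; u.2.2, v.2.2, w.2.2] := by
    have hsymm : ∀ x, prodEquivFun.symm x = (x 0, x 1, x 2) := fun _ => rfl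
    have happly : ∀ p, prodEquivFun p = ![p.1, p.2.1, p.2.2] := fun _ => rfl
    ext i j
    fin_cases i <;> fin_cases j <;>
      simp [LinearMap.toMatrix_apply, linearMapOfCols_apply, hsymm, happly]
  rw [← LinearMap.det_toMatrix (Module.Basis.ofEquivFun prodEquivFun), h, Matrix.det_fin_three]
  simp
  ring

/-- If `f` is supported on the image of the standard simplex under a linear map and pulls back to a
multiple of a monomial times linear forms, then its integral is given by a simplex moment. -/
theorem setIntegral_eq_simplexMoment {S : Set (ℝ × ℝ × ℝ)} (hS : MeasurableSet S)
    {f : ℝ × ℝ × ℝ → ℝ} (u v w : ℝ × ℝ × ℝ) (ψ : ℝ × ℝ × ℝ → ℝ × ℝ × ℝ) (κ : ℝ)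
    (ls : List (ℚ × ℚ × ℚ)) (i j k : ℕ)
    (hdet : LinearMap.det (linearMapOfCols u v w) ≠ 0)
    (hmaps : ∀ p ∈ openSimplex, linearMapOfCols u v w p ∈ S)
    (hsupp : ∀ q ∈ S, f q ≠ 0 → ψ q ∈ openSimplex ∧ linearMapOfCols u v w (ψ q) = q)
    (hf : ∀ p ∈ openSimplex, f (linearMapOfCols u v w p) =
      κ * (p.1 ^ i * (p.2.1 ^ j * p.2.2 ^ k) * (ls.map fun l => linForm l p).prod)) :
    ∫ q in S, f q =
      |LinearMap.det (linearMapOfCols u v w)| * (κ * simplexMoment ls i j k) := by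
  have himage : linearMapOfCols u v w '' openSimplex ⊆ S := Set.image_subset_iff.2 hmaps
  have hzero : ∀ q ∈ S \ linearMapOfCols u v w '' openSimplex, f q = 0 := by
    rintro q ⟨hq, hq'⟩
    by_contra hne
    exact hq' ⟨ψ q, hsupp q hq hne⟩
  have hinj : Function.Injective (linearMapOfCols u v w) :=
    (LinearMap.equivOfDetNeZero _ hdet).injective
  have hderiv : ∀ p ∈ openSimplex, HasFDerivWithinAt (linearMapOfCols u v w)
      (LinearMap.toContinuousLinearMap (linearMapOfCols u v w)) openSimplex p :=
    fun p _ => (LinearMap.toContinuousLinearMap (linearMapOfCols u v w)).hasFDerivWithinAt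
  have : (volume : Measure (ℝ × ℝ)).IsAddHaarMeasure :=
    Measure.prod.instIsAddHaarMeasure volume volume
  have : (volume : Measure (ℝ × ℝ × ℝ)).IsAddHaarMeasure :=
    Measure.prod.instIsAddHaarMeasure volume volume
  rw [setIntegral_eq_of_subset_of_forall_sdiff_eq_zero hS himage hzero,
    integral_image_eq_integral_abs_det_fderiv_smul volume isOpen_openSimplex.measurableSet
      hderiv hinj.injOn]
  simp only [smul_eq_mul, LinearMap.det_toContinuousLinearMap]
  rw [integral_const_mul, setIntegral_congr_fun isOpen_openSimplex.measurableSet hf,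
    integral_const_mul, integral_monomial_mul_linForms]

/-- The open tetrahedron with vertices `0`, `(4, 0, 0)`, `(0, 2, 0)` and `(0, 0, 4 / 3)`. -/
def tetra : Set (ℝ × ℝ × ℝ) :=
  {p | 0 < p.1 ∧ 0 < p.2.1 ∧ 0 < p.2.2 ∧ p.1 + 2 * p.2.1 + 3 * p.2.2 < 4}

theorem isOpen_tetra : IsOpen tetra := by
  refine .and (isOpen_lt ?_ ?_) (.and (isOpen_lt ?_ ?_)
    (.and (isOpen_lt ?_ ?_) (isOpen_lt ?_ ?_))) <;> fun_prop

theorem Continuous.integrableOn_tetra {f : ℝ × ℝ × ℝ → ℝ} (hf : Continuous f) :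
    IntegrableOn f tetra := by
  refine (hf.continuousOn.integrableOn_compact
    (K := Set.Icc (0, 0, 0) (4, 4, 4)) isCompact_Icc).mono_set ?_
  rintro ⟨a, b, c⟩ ⟨h1, h2, h3, h4⟩
  simp only [Set.mem_Icc, Prod.mk_le_mk] at h1 h2 h3 h4 ⊢
  refine ⟨⟨?_, ?_, ?_⟩, ?_, ?_, ?_⟩ <;> linarith

@[fun_prop]
theorem continuous_wDim : Continuous wDim := by
  unfold wDim
  fun_prop

theorem setIntegral_tetra {f : ℝ × ℝ × ℝ → ℝ} (κ : ℝ) (ls : List (ℚ × ℚ × ℚ)) (i j k : ℕ)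
    (hf : ∀ a b c : ℝ, f (4 * a, 2 * b, 4 / 3 * c) =
      κ * (a ^ i * (b ^ j * c ^ k) * (ls.map fun l => linForm l (a, b, c)).prod)) :
    ∫ q in tetra, f q = 32 / 3 * (κ * simplexMoment ls i j k) := by
  have happly : ∀ a b c : ℝ, linearMapOfCols (4, 0, 0) (0, 2, 0) (0, 0, 4 / 3) (a, b, c) =
      (4 * a, 2 * b, 4 / 3 * c) := by
    intro a b c
    simp [linearMapOfCols_apply, mul_comm]
  have hdet : LinearMap.det (linearMapOfCols (4, 0, 0) (0, 2, 0) (0, 0, 4 / 3)) = 32 / 3 := by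
    rw [det_linearMapOfCols]
    norm_num
  rw [setIntegral_eq_simplexMoment isOpen_tetra.measurableSet (4, 0, 0) (0, 2, 0) (0, 0, 4 / 3)
    (fun q => (q.1 / 4, q.2.1 / 2, 3 / 4 * q.2.2)) κ ls i j k, hdet,
    abs_of_pos (by norm_num)]
  · rw [hdet]
    norm_num
  · rintro ⟨a, b, c⟩ ⟨h1, h2, h3, h4⟩
    rw [happly]
    dsimp only at h1 h2 h3 h4
    refine ⟨?_, ?_, ?_, ?_⟩ <;> dsimp only <;> linarith
  · rintro ⟨x, y, z⟩ ⟨h1, h2, h3, h4⟩ -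
    dsimp only at h1 h2 h3 h4
    refine ⟨⟨?_, ?_, ?_, ?_⟩, ?_⟩
    · dsimp only
      linarith
    · dsimp only
      linarith
    · dsimp only
      linarith
    · dsimp only
      linarith
    · rw [happly]
      ext <;> dsimp only <;> ring
  · rintro ⟨a, b, c⟩ -
    rw [happly]
    exact hf a b c

/-- The integral of `max L 0 ^ 3 * wDim` over the tetrahedron, when the subset where the linear form
`L` is positive is the image of the standard simplex under a linear map. -/
theorem setIntegral_tetra_max {L : ℝ × ℝ × ℝ → ℝ} (u v w : ℝ × ℝ × ℝ)
    (ψ : ℝ × ℝ × ℝ → ℝ × ℝ × ℝ) {m : ℝ} (hm : 0 ≤ m) (κ : ℝ) (ls : List (ℚ × ℚ × ℚ)) (i j k : ℕ)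
    (hdet : LinearMap.det (linearMapOfCols u v w) ≠ 0)
    (hL : ∀ p, L (linearMapOfCols u v w p) = m * p.1)
    (hmaps : ∀ p ∈ openSimplex, linearMapOfCols u v w p ∈ tetra)
    (hpos : ∀ q ∈ tetra, 0 < L q → ψ q ∈ openSimplex)
    (hinv : ∀ q, linearMapOfCols u v w (ψ q) = q)
    (hw : ∀ p, wDim (linearMapOfCols u v w p) =
      κ * (p.1 ^ i * (p.2.1 ^ j * p.2.2 ^ k) * (ls.map fun l => linForm l p).prod)) :
    ∫ q in tetra, max (L q) 0 ^ 3 * wDim q =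
      |LinearMap.det (linearMapOfCols u v w)| *
        (m ^ 3 * κ * simplexMoment ls (i + 3) j k) := by
  refine setIntegral_eq_simplexMoment isOpen_tetra.measurableSet u v w ψ _ ls _ j k hdet hmaps
    (fun q hq hne => ⟨hpos q hq ?_, hinv q⟩) fun p hp => ?_
  · by_contra h
    exact hne (by simp [max_eq_right (not_lt.1 h)])
  · rw [hL, hw, max_eq_left (mul_nonneg hm hp.1.le)]
    ring

theorem setIntegral_tetra_xyz :
    ∫ q in tetra, q.1 * q.2.1 * q.2.2 * wDim q = 4096 / 467775 := by
  have hmoment : simplexMoment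
      [(4, 2, 0), (0, 2, 4 / 3), (4, 2, 4 / 3)]
      2 2 2 = 1 / 11550 := by
    decide +kernel
  rw [setIntegral_tetra (256 / 27) _ 2 2 2 ?_, hmoment]
  · norm_num
  · intro a b c
    simp only [wDim, linForm, List.map_cons, List.map_nil, List.prod_cons, List.prod_nil]
    push_cast
    ring

theorem setIntegral_tetra_y_cubed :
    ∫ q in tetra, q.2.1 ^ 3 * wDim q = 33536 / 1403325 := by
  have hmoment : simplexMoment
      [(4, 2, 0), (0, 2, 4 / 3), (4, 2, 4 / 3)]
      1 4 1 = 131 / 415800 := by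
    decide +kernel
  rw [setIntegral_tetra (64 / 9) _ 1 4 1 ?_, hmoment]
  · norm_num
  · intro a b c
    simp only [wDim, linForm, List.map_cons, List.map_nil, List.prod_cons, List.prod_nil]
    push_cast
    ring

theorem setIntegral_tetra_y_mul_sq :
    ∫ q in tetra, q.2.1 * (q.1 + q.2.2 - q.2.1) ^ 2 * wDim q = 10117376 / 341007975 := by
  have hmoment : simplexMoment
      [(4, -2, 4 / 3), (4, -2, 4 / 3), (4, 2, 0), (0, 2, 4 / 3), (4, 2, 4 / 3)]
      1 2 1 = 39521 / 25259850 := by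
    decide +kernel
  rw [setIntegral_tetra (16 / 9) _ 1 2 1 ?_, hmoment]
  · norm_num
  · intro a b c
    simp only [wDim, linForm, List.map_cons, List.map_nil, List.prod_cons, List.prod_nil]
    push_cast
    ring

theorem setIntegral_tetra_max_y :
    ∫ q in tetra, max (2 * q.2.1 - q.1 - q.2.2) 0 ^ 3 * wDim q = 48113 / 1247400 := by
  have hdet : LinearMap.det (linearMapOfCols (0, 2, 0) (2, 1, 0) (0, 1 / 2, 1)) = -4 := by
    rw [det_linearMapOfCols]
    norm_num
  have hmoment : simplexMoment
      [(2, 1, 1 / 2), (2, 3, 1 / 2), (2, 1, 3 / 2), (2, 3, 3 / 2)]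
      3 1 1 = 48113 / 53222400 := by
    decide +kernel
  rw [setIntegral_tetra_max (L := fun q => 2 * q.2.1 - q.1 - q.2.2)
    (0, 2, 0) (2, 1, 0) (0, 1 / 2, 1)
    (fun q => ((2 * q.2.1 - q.1 - q.2.2) / 4, q.1 / 2, q.2.2))
    (m := 4) (by norm_num) (1 / 6)
    [(2, 1, 1 / 2), (2, 3, 1 / 2), (2, 1, 3 / 2), (2, 3, 3 / 2)] 0 1 1, hdet, hmoment]
  · norm_num
  · rw [hdet]
    norm_num
  · intro p
    simp only [linearMapOfCols_apply, Prod.fst_add, Prod.snd_add, Prod.smul_mk, smul_eq_mul]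
    ring
  · rintro ⟨a, b, c⟩ ⟨h1, h2, h3, h4⟩
    dsimp only at h1 h2 h3 h4
    refine ⟨?_, ?_, ?_, ?_⟩ <;>
      simp only [linearMapOfCols_apply, Prod.fst_add, Prod.snd_add, Prod.smul_mk, smul_eq_mul] <;>
      linarith
  · rintro ⟨x, y, z⟩ ⟨h1, h2, h3, h4⟩ h5
    dsimp only at h1 h2 h3 h4 h5
    refine ⟨?_, ?_, ?_, ?_⟩ <;> dsimp only <;> linarith
  · rintro ⟨x, y, z⟩
    ext <;>
      simp only [linearMapOfCols_apply, Prod.fst_add, Prod.snd_add, Prod.smul_mk, smul_eq_mul] <;>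
      ring
  · intro p
    simp only [wDim, linearMapOfCols_apply, Prod.fst_add, Prod.snd_add, Prod.smul_mk, smul_eq_mul,
      linForm, List.map_cons, List.map_nil, List.prod_cons, List.prod_nil]
    push_cast
    ring

theorem setIntegral_tetra_max_z_sub_x :
    ∫ q in tetra, max (q.2.2 - 3 * q.1) 0 ^ 3 * wDim q = 7442432 / 355216640625 := by
  have hdet : LinearMap.det (linearMapOfCols (0, 0, 4 / 3) (0, 2, 0) (2 / 5, 0, 6 / 5)) = -16 / 15 := by
    rw [det_linearMapOfCols]
    norm_num
  have hmoment : simplexMoment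
      [(4 / 3, 0, 6 / 5), (0, 2, 2 / 5), (4 / 3, 2, 6 / 5), (4 / 3, 2, 8 / 5)]
      3 1 1 = 7268 / 58471875 := by
    decide +kernel
  rw [setIntegral_tetra_max (L := fun q => q.2.2 - 3 * q.1)
    (0, 0, 4 / 3) (0, 2, 0) (2 / 5, 0, 6 / 5)
    (fun q => ((q.2.2 - 3 * q.1) * (3 / 4), q.2.1 / 2, q.1 * (5 / 2)))
    (m := 4 / 3) (by norm_num) (1 / 15)
    [(4 / 3, 0, 6 / 5), (0, 2, 2 / 5), (4 / 3, 2, 6 / 5), (4 / 3, 2, 8 / 5)] 0 1 1, hdet, hmoment]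
  · norm_num
  · rw [hdet]
    norm_num
  · intro p
    simp only [linearMapOfCols_apply, Prod.fst_add, Prod.snd_add, Prod.smul_mk, smul_eq_mul]
    ring
  · rintro ⟨a, b, c⟩ ⟨h1, h2, h3, h4⟩
    dsimp only at h1 h2 h3 h4
    refine ⟨?_, ?_, ?_, ?_⟩ <;>
      simp only [linearMapOfCols_apply, Prod.fst_add, Prod.snd_add, Prod.smul_mk, smul_eq_mul] <;>
      linarith
  · rintro ⟨x, y, z⟩ ⟨h1, h2, h3, h4⟩ h5
    dsimp only at h1 h2 h3 h4 h5
    refine ⟨?_, ?_, ?_, ?_⟩ <;> dsimp only <;> linarith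
  · rintro ⟨x, y, z⟩
    ext <;>
      simp only [linearMapOfCols_apply, Prod.fst_add, Prod.snd_add, Prod.smul_mk, smul_eq_mul] <;>
      ring
  · intro p
    simp only [wDim, linearMapOfCols_apply, Prod.fst_add, Prod.snd_add, Prod.smul_mk, smul_eq_mul,
      linForm, List.map_cons, List.map_nil, List.prod_cons, List.prod_nil]
    push_cast
    ring

theorem setIntegral_tetra_max_x_sub_z :
    ∫ q in tetra, max (q.1 - 3 * q.2.2) 0 ^ 3 * wDim q = 671744 / 12629925 := by
  have hdet : LinearMap.det (linearMapOfCols (4, 0, 0) (0, 2, 0) (2, 0, 2 / 3)) = 16 / 3 := by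
    rw [det_linearMapOfCols]
    norm_num
  have hmoment : simplexMoment
      [(4, 0, 2), (4, 2, 2), (0, 2, 2 / 3), (4, 2, 8 / 3)]
      3 1 1 = 656 / 467775 := by
    decide +kernel
  rw [setIntegral_tetra_max (L := fun q => q.1 - 3 * q.2.2)
    (4, 0, 0) (0, 2, 0) (2, 0, 2 / 3)
    (fun q => ((q.1 - 3 * q.2.2) / 4, q.2.1 / 2, q.2.2 * (3 / 2)))
    (m := 4) (by norm_num) (1 / 9)
    [(4, 0, 2), (4, 2, 2), (0, 2, 2 / 3), (4, 2, 8 / 3)] 0 1 1, hdet, hmoment]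
  · norm_num
  · rw [hdet]
    norm_num
  · intro p
    simp only [linearMapOfCols_apply, Prod.fst_add, Prod.snd_add, Prod.smul_mk, smul_eq_mul]
    ring
  · rintro ⟨a, b, c⟩ ⟨h1, h2, h3, h4⟩
    dsimp only at h1 h2 h3 h4
    refine ⟨?_, ?_, ?_, ?_⟩ <;>
      simp only [linearMapOfCols_apply, Prod.fst_add, Prod.snd_add, Prod.smul_mk, smul_eq_mul] <;>
      linarith
  · rintro ⟨x, y, z⟩ ⟨h1, h2, h3, h4⟩ h5
    dsimp only at h1 h2 h3 h4 h5
    refine ⟨?_, ?_, ?_, ?_⟩ <;> dsimp only <;> linarith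
  · rintro ⟨x, y, z⟩
    ext <;>
      simp only [linearMapOfCols_apply, Prod.fst_add, Prod.snd_add, Prod.smul_mk, smul_eq_mul] <;>
      ring
  · intro p
    simp only [wDim, linearMapOfCols_apply, Prod.fst_add, Prod.snd_add, Prod.smul_mk, smul_eq_mul,
      linForm, List.map_cons, List.map_nil, List.prod_cons, List.prod_nil]
    push_cast
    ring

theorem setIntegral_tetra_max_x :
    ∫ q in tetra, max (q.1 - 2 * q.2.1 - 3 * q.2.2) 0 ^ 3 * wDim q = 22184 / 1804275 := by
  have hdet : LinearMap.det (linearMapOfCols (4, 0, 0) (2, 1, 0) (2, 0, 2 / 3)) = 8 / 3 := by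
    rw [det_linearMapOfCols]
    norm_num
  have hmoment : simplexMoment
      [(4, 2, 2), (4, 3, 2), (0, 1, 2 / 3), (4, 3, 8 / 3)]
      3 1 1 = 2773 / 2138400 := by
    decide +kernel
  rw [setIntegral_tetra_max (L := fun q => q.1 - 2 * q.2.1 - 3 * q.2.2)
    (4, 0, 0) (2, 1, 0) (2, 0, 2 / 3)
    (fun q => ((q.1 - 2 * q.2.1 - 3 * q.2.2) / 4, q.2.1, q.2.2 * (3 / 2)))
    (m := 4) (by norm_num) (1 / 18)
    [(4, 2, 2), (4, 3, 2), (0, 1, 2 / 3), (4, 3, 8 / 3)] 0 1 1, hdet, hmoment]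
  · norm_num
  · rw [hdet]
    norm_num
  · intro p
    simp only [linearMapOfCols_apply, Prod.fst_add, Prod.snd_add, Prod.smul_mk, smul_eq_mul]
    ring
  · rintro ⟨a, b, c⟩ ⟨h1, h2, h3, h4⟩
    dsimp only at h1 h2 h3 h4
    refine ⟨?_, ?_, ?_, ?_⟩ <;>
      simp only [linearMapOfCols_apply, Prod.fst_add, Prod.snd_add, Prod.smul_mk, smul_eq_mul] <;>
      linarith
  · rintro ⟨x, y, z⟩ ⟨h1, h2, h3, h4⟩ h5
    dsimp only at h1 h2 h3 h4 h5
    refine ⟨?_, ?_, ?_, ?_⟩ <;> dsimp only <;> linarith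
  · rintro ⟨x, y, z⟩
    ext <;>
      simp only [linearMapOfCols_apply, Prod.fst_add, Prod.snd_add, Prod.smul_mk, smul_eq_mul] <;>
      ring
  · intro p
    simp only [wDim, linearMapOfCols_apply, Prod.fst_add, Prod.snd_add, Prod.smul_mk, smul_eq_mul,
      linForm, List.map_cons, List.map_nil, List.prod_cons, List.prod_nil]
    push_cast
    ring

theorem setIntegral_tetra_max_z :
    ∫ q in tetra, max (q.2.2 - 2 * q.2.1 - 3 * q.1) 0 ^ 3 * wDim q = 522527 / 947244375000 := by
  have hdet : LinearMap.det (linearMapOfCols (0, 0, 4 / 3) (2 / 5, 0, 6 / 5) (0, 1 / 2, 1)) = 4 / 15 := by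
    rw [det_linearMapOfCols]
    norm_num
  have hmoment : simplexMoment
      [(4 / 3, 6 / 5, 1), (0, 2 / 5, 1 / 2), (4 / 3, 6 / 5, 3 / 2), (4 / 3, 8 / 5, 3 / 2)]
      3 1 1 = 522527 / 9979200000 := by
    decide +kernel
  rw [setIntegral_tetra_max (L := fun q => q.2.2 - 2 * q.2.1 - 3 * q.1)
    (0, 0, 4 / 3) (2 / 5, 0, 6 / 5) (0, 1 / 2, 1)
    (fun q => ((q.2.2 - 2 * q.2.1 - 3 * q.1) * (3 / 4), q.1 * (5 / 2), 2 * q.2.1))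
    (m := 4 / 3) (by norm_num) (1 / 60)
    [(4 / 3, 6 / 5, 1), (0, 2 / 5, 1 / 2), (4 / 3, 6 / 5, 3 / 2), (4 / 3, 8 / 5, 3 / 2)] 0 1 1, hdet, hmoment]
  · norm_num
  · rw [hdet]
    norm_num
  · intro p
    simp only [linearMapOfCols_apply, Prod.fst_add, Prod.snd_add, Prod.smul_mk, smul_eq_mul]
    ring
  · rintro ⟨a, b, c⟩ ⟨h1, h2, h3, h4⟩
    dsimp only at h1 h2 h3 h4
    refine ⟨?_, ?_, ?_, ?_⟩ <;>
      simp only [linearMapOfCols_apply, Prod.fst_add, Prod.snd_add, Prod.smul_mk, smul_eq_mul] <;>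
      linarith
  · rintro ⟨x, y, z⟩ ⟨h1, h2, h3, h4⟩ h5
    dsimp only at h1 h2 h3 h4 h5
    refine ⟨?_, ?_, ?_, ?_⟩ <;> dsimp only <;> linarith
  · rintro ⟨x, y, z⟩
    ext <;>
      simp only [linearMapOfCols_apply, Prod.fst_add, Prod.snd_add, Prod.smul_mk, smul_eq_mul] <;>
      ring
  · intro p
    simp only [wDim, linearMapOfCols_apply, Prod.fst_add, Prod.snd_add, Prod.smul_mk, smul_eq_mul,
      linForm, List.map_cons, List.map_nil, List.prod_cons, List.prod_nil]
    push_cast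
    ring

/-- `12!/4` times the integral of `g · w` over the polytope attached to
the weight `λ = 4ω₁` equals `56960`, the number of twisted cubics tangent to 12 general
planes. -/
theorem stmt_8 :
    119750400 * ∫ p in {p : ℝ × ℝ × ℝ | 0 < p.1 ∧ 0 < p.2.1 ∧ 0 < p.2.2 ∧
        p.1 + 2 * p.2.1 + 3 * p.2.2 < 4 ∧ 3 * p.1 + 2 * p.2.1 + p.2.2 < 12 ∧
        p.1 + 2 * p.2.1 + p.2.2 < 4},
      gInv p * wDim p = 56960 := by
  have hregion : {p : ℝ × ℝ × ℝ | 0 < p.1 ∧ 0 < p.2.1 ∧ 0 < p.2.2 ∧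
      p.1 + 2 * p.2.1 + 3 * p.2.2 < 4 ∧ 3 * p.1 + 2 * p.2.1 + p.2.2 < 12 ∧
      p.1 + 2 * p.2.1 + p.2.2 < 4} = tetra := by
    ext p
    refine ⟨fun ⟨h1, h2, h3, h4, _⟩ => ⟨h1, h2, h3, h4⟩, fun ⟨h1, h2, h3, h4⟩ =>
      ⟨h1, h2, h3, h4, by linarith, by linarith⟩⟩
  have hexp : ∀ q : ℝ × ℝ × ℝ, gInv q * wDim q = (1 / 576) *
      (48 * (q.1 * q.2.1 * q.2.2 * wDim q) - 2 * (q.2.1 ^ 3 * wDim q) -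
        6 * (q.2.1 * (q.1 + q.2.2 - q.2.1) ^ 2 * wDim q) +
        max (2 * q.2.1 - q.1 - q.2.2) 0 ^ 3 * wDim q +
        max (q.2.2 - 3 * q.1) 0 ^ 3 * wDim q + max (q.1 - 3 * q.2.2) 0 ^ 3 * wDim q -
        max (q.1 - 2 * q.2.1 - 3 * q.2.2) 0 ^ 3 * wDim q -
        max (q.2.2 - 2 * q.2.1 - 3 * q.1) 0 ^ 3 * wDim q) := by
    intro q
    rw [gInv]
    ring
  simp_rw [hregion, hexp]
  rw [integral_const_mul,
    integral_sub (Continuous.integrableOn_tetra (by fun_prop))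
      (Continuous.integrableOn_tetra (by fun_prop)),
    integral_sub (Continuous.integrableOn_tetra (by fun_prop))
      (Continuous.integrableOn_tetra (by fun_prop)),
    integral_add (Continuous.integrableOn_tetra (by fun_prop))
      (Continuous.integrableOn_tetra (by fun_prop)),
    integral_add (Continuous.integrableOn_tetra (by fun_prop))
      (Continuous.integrableOn_tetra (by fun_prop)),
    integral_add (Continuous.integrableOn_tetra (by fun_prop))
      (Continuous.integrableOn_tetra (by fun_prop)),
    integral_sub (Continuous.integrableOn_tetra (by fun_prop))
      (Continuous.integrableOn_tetra (by fun_prop)),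
    integral_sub (Continuous.integrableOn_tetra (by fun_prop))
      (Continuous.integrableOn_tetra (by fun_prop)),
    integral_const_mul, integral_const_mul, integral_const_mul, setIntegral_tetra_xyz,
    setIntegral_tetra_y_cubed, setIntegral_tetra_y_mul_sq, setIntegral_tetra_max_y,
    setIntegral_tetra_max_z_sub_x, setIntegral_tetra_max_x_sub_z, setIntegral_tetra_max_x,
    setIntegral_tetra_max_z]
  norm_num
end
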